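/- For integers α ≥ β ≥ 0, the following identity holds in ℚ[[q]]: Σ_{i=β}^{α} q^{i(i+1)/2} q^{β(β+1)/2} / ((q)_{α−i} (q)_{i−β}) = q^{β(β+1)} · (−q^{β+1}; q)_{α−β} / (q)_{α−β}, where (−q^{β+1}; q)_n = ∏_{i=0}^{n−1} (1 + q^{β+1+i}). -/

import Mathlib

open PowerSeries

noncomputable section

/-- The product (coefficientwise) topology on `ℚ⟦X⟧`. -/
instance : TopologicalSpace ℚ⟦X⟧ :=
  inferInstanceAs (TopologicalSpace ((Unit →₀ ℕ) → ℚ))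

/-- `(q)_n = ∏_{i=1}^n (1 - q^i)` in `ℚ⟦X⟧`. -/
def qp (n : ℕ) : ℚ⟦X⟧ := ∏ i ∈ Finset.range n, (1 - X ^ (i + 1))

/-- `(-q)_n = ∏_{i=1}^n (1 + q^i)` in `ℚ⟦X⟧`. -/
def nqp (n : ℕ) : ℚ⟦X⟧ := ∏ i ∈ Finset.range n, (1 + X ^ (i + 1))

/-- The Gaussian binomial `[M, N]_q`, zero unless `M ≥ N`. -/
def qbinom (M N : ℕ) : ℚ⟦X⟧ :=
  if N ≤ M then qp M * ((qp N)⁻¹ * (qp (M - N))⁻¹) else 0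

/-- Weakly decreasing tuples `f 0 ≥ f 1 ≥ … ≥ f (r-1) ≥ 0`, encoded as
antitone functions `ℕ → ℕ` vanishing from index `r` on. -/
def DecTuple (r : ℕ) : Type :=
  {f : ℕ → ℕ // (∀ ⦃i j : ℕ⦄, i ≤ j → f j ≤ f i) ∧ ∀ i, r ≤ i → f i = 0}

/-- `(q)_λ = (q)_{λ_1-λ_2} ⋯ (q)_{λ_{r-1}-λ_r} (q)_{λ_r}` for a weakly
decreasing tuple `λ` (0-indexed). -/
def qpT (r : ℕ) (f : ℕ → ℕ) : ℚ⟦X⟧ := ∏ i ∈ Finset.range r, qp (f i - f (i + 1))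


theorem qp_succ (n : ℕ) : qp (n + 1) = qp n * (1 - X ^ (n + 1)) :=
  Finset.prod_range_succ _ _

theorem constantCoeff_qp (n : ℕ) : constantCoeff (qp n) = 1 := by
  simp [qp, map_prod]

theorem qp_inv_mul_cancel (n : ℕ) : (qp n)⁻¹ * qp n = 1 :=
  PowerSeries.inv_mul_cancel _ (by simp [constantCoeff_qp])

theorem one_sub_mul_qp_inv_succ (n : ℕ) :
    (1 - X ^ (n + 1)) * (qp (n + 1))⁻¹ = (qp n)⁻¹ := by
  have h₁ := qp_inv_mul_cancel n
  have h₂ := qp_inv_mul_cancel (n + 1)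
  rw [qp_succ] at h₂ ⊢
  linear_combination (qp n)⁻¹ * h₂ - (qp n * (1 - X ^ (n + 1)))⁻¹ * (1 - X ^ (n + 1)) * h₁

/-- The finite `q`-binomial theorem, divided by `(q)_n`. -/
theorem sum_antidiagonal_qp_inv (z : ℚ⟦X⟧) (n : ℕ) :
    ∑ p ∈ Finset.HasAntidiagonal.antidiagonal n,
        X ^ p.1.choose 2 * z ^ p.1 * ((qp p.2)⁻¹ * (qp p.1)⁻¹) =
      (∏ i ∈ Finset.range n, (1 + z * X ^ i)) * (qp n)⁻¹ := by
  induction n with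
  | zero =>
    have h₀ : (qp 0)⁻¹ = 1 := by simp [qp]
    simp [h₀]
  | succ n ih =>
    have hne : (1 - X ^ (n + 1) : ℚ⟦X⟧) ≠ 0 := fun h => by
      simpa using congrArg constantCoeff h
    apply mul_left_cancel₀ hne
    rw [mul_left_comm, one_sub_mul_qp_inv_succ, Finset.prod_range_succ, mul_right_comm, ← ih]
    have hsplit : ∀ p ∈ Finset.HasAntidiagonal.antidiagonal (n + 1),
        (1 - X ^ (n + 1)) * (X ^ p.1.choose 2 * z ^ p.1 * ((qp p.2)⁻¹ * (qp p.1)⁻¹)) =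
          X ^ p.1.choose 2 * z ^ p.1 * (((1 - X ^ p.2) * (qp p.2)⁻¹) * (qp p.1)⁻¹) +
          X ^ p.1.choose 2 * z ^ p.1 * X ^ p.2 * ((qp p.2)⁻¹ * ((1 - X ^ p.1) * (qp p.1)⁻¹)) := by
      intro p hp
      rw [← Finset.HasAntidiagonal.mem_antidiagonal.mp hp, pow_add]
      ring
    rw [Finset.mul_sum, Finset.sum_congr rfl hsplit, Finset.sum_add_distrib,
      Finset.Nat.sum_antidiagonal_succ', Finset.Nat.sum_antidiagonal_succ]
    simp only [one_sub_mul_qp_inv_succ, pow_zero, sub_self, zero_mul, mul_zero, zero_add,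
      mul_add, mul_one]
    congr 1
    rw [Finset.sum_mul]
    refine Finset.sum_congr rfl fun p hp => ?_
    rw [← Finset.HasAntidiagonal.mem_antidiagonal.mp hp, Nat.choose_succ_succ' p.1 1, Nat.choose_one_right]
    ring

theorem add_mul_add_succ_div_two (b j : ℕ) :
    (b + j) * (b + j + 1) / 2 + b * (b + 1) / 2 = b * (b + 1) + (j.choose 2 + (b + 1) * j) := by
  have h (m : ℕ) : m * (m + 1) / 2 = (m + 1).choose 2 := by
    rw [Nat.choose_two_right, Nat.add_sub_cancel, mul_comm]
  have hb := Nat.div_mul_cancel (Nat.even_mul_succ_self b).two_dvd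
  rw [h] at hb
  rw [h, h, add_right_comm, Nat.add_choose_eq]
  simp [Finset.Nat.antidiagonal_succ]
  linarith

/-- `Σ_{i=β}^{α} q^{i(i+1)/2} q^{β(β+1)/2}/((q)_{α-i}(q)_{i-β}) =
q^{β(β+1)} (-q^{β+1};q)_{α-β}/(q)_{α-β}`. -/
theorem stmt8 (α β : ℕ) (h : β ≤ α) :
    ∑ i ∈ Finset.Icc β α,
        (X : ℚ⟦X⟧) ^ (i * (i + 1) / 2) * (X : ℚ⟦X⟧) ^ (β * (β + 1) / 2) *
          ((qp (α - i))⁻¹ * (qp (i - β))⁻¹) =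
      (X : ℚ⟦X⟧) ^ (β * (β + 1)) *
        (∏ i ∈ Finset.range (α - β), (1 + (X : ℚ⟦X⟧) ^ (β + 1 + i))) *
        (qp (α - β))⁻¹ := by
  obtain ⟨n, rfl⟩ := Nat.exists_eq_add_of_le h
  have hprod : ∏ i ∈ Finset.range n, (1 + (X : ℚ⟦X⟧) ^ (β + 1 + i)) =
      ∏ i ∈ Finset.range n, (1 + X ^ (β + 1) * X ^ i) := by
    simp only [pow_add]
  rw [Nat.add_sub_cancel_left, hprod, mul_assoc, ← sum_antidiagonal_qp_inv, Finset.mul_sum,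
    Finset.Nat.sum_antidiagonal_eq_sum_range_succ_mk, ← Finset.Ico_succ_right_eq_Icc,
    Finset.sum_Ico_eq_sum_range]
  refine Finset.sum_congr (congrArg _ (by simp; omega)) fun j _ => ?_
  rw [← pow_add, add_mul_add_succ_div_two, Nat.add_sub_add_left, Nat.add_sub_cancel_left,
    pow_add X (β * (β + 1)), pow_add X (j.choose 2), pow_mul X (β + 1), mul_assoc]
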